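/- arXiv:1509.07056 — 4 statements merged into one kernel-verified Lean document; each statement's English description precedes it below -/
import Mathlib

section
/- Consider the charging game with individual influence windows and memoryless costs: the payoff of player i is u_i(s) = −f_i( Σ_{t = s_i}^{s_i + C_i − 1} c_t(L_t(s)) + g_i^EV(s_i) ), where each c_t : ℝ → ℝ is an arbitrary function of the current load only (no thermal inertia), each g_i^EV : S_i → ℝ is arbitrary, and each f_i : ℝ → ℝ is strictly increasing. Then the function Φ_b(s) = −Σ_{t=1}^{T} Σ_{v=0}^{n_t(s)} c_t(L^exo_t + P·v) − Σ_{j=1}^I g_j^EV(s_j) is an ordinal potential for this game; in particular the game is an ordinal potential game. (Proposition IV.1, case (b).) -/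
open Finset in
/-- If player `i` charges exactly on the window `Icc x (x + C i - 1) ⊆ Icc 1 T`, then the Rosenthal
sum splits into the sum generated by the other players and the cost seen by player `i`. -/
lemma sum_sum_range_card_update_eq {I T : ℕ} (C : Fin I → ℕ) (i : Fin I) (hC : 1 ≤ C i)
    (h : ℕ → ℕ → ℝ) (n : ℕ → (Fin I → ℕ) → ℕ)
    (hn : ∀ t s, n t s = #{j : Fin I | s j ≤ t ∧ t < s j + C j})
    (s : Fin I → ℕ) (x : ℕ) (hx : 1 ≤ x) (hxT : x + C i - 1 ≤ T) :
    ∑ t ∈ Icc 1 T, ∑ v ∈ range (n t (Function.update s i x) + 1), h t v =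
      (∑ t ∈ Icc 1 T,
        ∑ v ∈ range (#{j ∈ univ.erase i | s j ≤ t ∧ t < s j + C j} + 1), h t v) +
      ∑ t ∈ Icc x (x + C i - 1), h t (n t (Function.update s i x)) := by
  have hcard (t : ℕ) : n t (Function.update s i x) =
      #{j ∈ univ.erase i | s j ≤ t ∧ t < s j + C j} +
        if t ∈ Icc x (x + C i - 1) then 1 else 0 := by
    have hmem : t ∈ Icc x (x + C i - 1) ↔ x ≤ t ∧ t < x + C i := by
      rw [mem_Icc]; lia
    have hcongr : {j ∈ univ.erase i | Function.update s i x j ≤ t ∧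
        t < Function.update s i x j + C j} =
        {j ∈ univ.erase i | s j ≤ t ∧ t < s j + C j} := by
      refine filter_congr fun j hj => ?_
      rw [Function.update_of_ne (ne_of_mem_erase hj)]
    rw [hn, ← insert_erase (mem_univ i), filter_insert, Function.update_self, hcongr]
    simp only [hmem]
    split_ifs
    · rw [card_insert_of_notMem (by simp)]
      simp
    · simp
  have hsub : Icc x (x + C i - 1) ⊆ Icc 1 T := Icc_subset_Icc hx hxT
  rw [← inter_eq_right.mpr hsub, ← sum_ite_mem, ← sum_add_distrib]
  refine sum_congr rfl fun t _ => ?_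
  rw [hcard]
  split_ifs
  · rw [sum_range_succ]
  · simp

/-- **Proposition IV.1, case (b).** In the charging game with individual influence windows
`W_i(s_i) = {s_i, …, s_i + C_i − 1}` and memoryless per-slot costs `c_t(L_t(s))` (no thermal
inertia), the function
`Φ_b(s) = −Σ_{t=1}^T Σ_{v=0}^{n_t(s)} c_t(L^exo_t + P v) − Σ_j g_j^EV(s_j)`
is an ordinal potential. -/
theorem charging_game_individual_window_ordinal_potential
    (I T : ℕ) (hI : 1 ≤ I) (hT : 1 ≤ T)
    -- arrival times, departure times, charging durations
    (a d C : Fin I → ℕ)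
    (ha1 : ∀ i, 1 ≤ a i) (hC1 : ∀ i, 1 ≤ C i)
    (had : ∀ i, a i ≤ d i - C i + 1) (hdT : ∀ i, d i ≤ T)
    -- exogenous load and common charging power
    (Lexo : ℕ → ℝ) (P : ℝ) (hP : 0 < P)
    -- memoryless per-slot cost: c t depends on the current load only
    (c : ℕ → ℝ → ℝ)
    -- individual costs
    (gEV : Fin I → ℕ → ℝ)
    -- strictly increasing individual pricing functions
    (f : Fin I → ℝ → ℝ) (hf : ∀ i, StrictMono (f i))
    -- number of EVs charging at time t: those with t ∈ {s_i, …, s_i + C_i − 1}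
    (n : ℕ → (Fin I → ℕ) → ℕ)
    (hn : ∀ t s, n t s =
      (Finset.univ.filter (fun i : Fin I => s i ≤ t ∧ t < s i + C i)).card)
    -- total load at time t
    (L : ℕ → (Fin I → ℕ) → ℝ)
    (hL : ∀ t s, L t s = Lexo t + P * (n t s : ℝ))
    -- payoff functions: player i only accounts for the slots of its own window
    (u : Fin I → (Fin I → ℕ) → ℝ)
    (hu : ∀ i s, u i s =
      - f i ((∑ t ∈ Finset.Icc (s i) (s i + C i - 1), c t (L t s)) + gEV i (s i)))
    -- candidate ordinal potential
    (Φ : (Fin I → ℕ) → ℝ)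
    (hΦ : ∀ s, Φ s =
      - (∑ t ∈ Finset.Icc 1 T, ∑ v ∈ Finset.range (n t s + 1), c t (Lexo t + P * (v : ℝ)))
      - ∑ j, gEV j (s j)) :
    -- Φ is an ordinal potential: unilateral deviations (within the action sets
    -- S_i = {a_i, …, d_i − C_i + 1}) improve u_i iff they improve Φ
    ∀ (i : Fin I) (s : Fin I → ℕ),
      (∀ j, s j ∈ Finset.Icc (a j) (d j - C j + 1)) →
      ∀ si' ∈ Finset.Icc (a i) (d i - C i + 1),
        (u i (Function.update s i si') ≥ u i s ↔
          Φ (Function.update s i si') ≥ Φ s) := by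
  intro i s hs x hx
  have hsi := hs i
  rw [Finset.mem_Icc] at hsi hx
  have ha := ha1 i
  have hC := hC1 i
  have hd := hdT i
  rcases lt_or_ge (d i) (C i) with hlt | hle
  · obtain rfl : x = s i := by lia
    simp
  · have key (y : ℕ) (hy : 1 ≤ y) (hyT : y + C i - 1 ≤ T) :=
      sum_sum_range_card_update_eq C i hC (fun t v => c t (Lexo t + P * (v : ℝ))) n hn s y hy hyT
    have hg (y : ℕ) : ∑ j, gEV j (Function.update s i y j) =
        gEV i y + ∑ j ∈ Finset.univ.erase i, gEV j (s j) := by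
      rw [← Finset.add_sum_erase _ _ (Finset.mem_univ i), Function.update_self]
      congr 1
      refine Finset.sum_congr rfl fun j hj => ?_
      rw [Function.update_of_ne (Finset.ne_of_mem_erase hj)]
    have hkx := key x (by lia) (by lia)
    have hks := key (s i) (by lia) (by lia)
    have hgx := hg x
    have hgs := hg (s i)
    rw [Function.update_eq_self] at hks hgs
    simp only [hu, hΦ, hL, hkx, hks, hgx, hgs, Function.update_self, ge_iff_le, neg_le_neg_iff,
      (hf i).le_iff_le]
    constructor <;> intro h <;> linarith
end

section
/- Let T ≥ 1, L : {1,…,T} → ℝ, p > 0 and 0 ≤ C ≤ T, and let X̃ = {x ∈ ℝ^T : 0 ≤ x_t ≤ 1 for all t, Σ_{t=1}^T x_t = C}. (i) For every strictly convex differentiable function f : ℝ → ℝ, the function x ↦ Σ_{t=1}^T f(L_t + p x_t) attains its minimum on X̃ at a unique point. (ii) The minimizer is independent of the strictly convex cost: if f and g are both strictly convex and differentiable, then the unique minimizer of x ↦ Σ_{t=1}^T f(L_t + p x_t) on X̃ equals the unique minimizer of x ↦ Σ_{t=1}^T g(L_t + p x_t) on X̃. (Valley-filling uniqueness and cost-independence,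 used in the proof of Proposition IV.4.) -/
/-- Moving two points towards each other strictly decreases the sum of the values of a strictly
convex function. -/
theorem StrictConvexOn.add_lt_add_of_transfer {f : ℝ → ℝ} (hf : StrictConvexOn ℝ Set.univ f)
    {a b δ : ℝ} (hδ : 0 < δ) (hδab : δ < b - a) : f (a + δ) + f (b - δ) < f a + f b := by
  have hab : 0 < b - a := hδ.trans hδab
  obtain ⟨s, rfl⟩ : ∃ s, δ = s * (b - a) := ⟨δ / (b - a), by field_simp⟩
  have hs0 : 0 < s := pos_of_mul_pos_left hδ hab.le
  have hs1 : 0 < 1 - s := by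
    by_contra! h
    nlinarith
  have hne : a ≠ b := (sub_pos.1 hab).ne
  have h1 := hf.2 (Set.mem_univ a) (Set.mem_univ b) hne hs1 hs0 (by ring)
  have h2 := hf.2 (Set.mem_univ a) (Set.mem_univ b) hne hs0 hs1 (by ring)
  simp only [smul_eq_mul] at h1 h2
  rw [show a + s * (b - a) = (1 - s) * a + s * b by ring,
    show b - s * (b - a) = s * a + (1 - s) * b by ring]
  linarith

/-- The vectors in the unit cube of `ℝ^ι` whose coordinates sum to `C`. -/
def cubeSlice (ι : Type*) [Fintype ι] (C : ℝ) : Set (ι → ℝ) :=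
  {x | (∀ t, 0 ≤ x t ∧ x t ≤ 1) ∧ ∑ t, x t = C}

theorem isCompact_cubeSlice (ι : Type*) [Fintype ι] (C : ℝ) : IsCompact (cubeSlice ι C) := by
  have h : cubeSlice ι C = Set.Icc 0 1 ∩ {x | ∑ t, x t = C} := by
    ext x
    simp [cubeSlice, Pi.le_def, forall_and]
  rw [h]
  exact isCompact_Icc.inter_right (isClosed_eq (by fun_prop) continuous_const)

theorem cubeSlice_nonempty {ι : Type*} [Fintype ι] [Nonempty ι] {C : ℝ} (hC0 : 0 ≤ C)
    (hC : C ≤ Fintype.card ι) : (cubeSlice ι C).Nonempty := by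
  have hcard : (0 : ℝ) < Fintype.card ι := by exact_mod_cast Fintype.card_pos
  refine ⟨fun _ => C / Fintype.card ι, fun _ => ⟨by positivity, (div_le_one hcard).2 hC⟩, ?_⟩
  simp only [Finset.sum_const, Finset.card_univ, nsmul_eq_mul]
  field_simp

/-- Optimality forces the water-filling condition: a slot with spare capacity is at least as
loaded as any slot in use. -/
theorem le_of_isMinOn_cubeSlice {ι : Type*} [Fintype ι] {L : ι → ℝ} {p C : ℝ} (hp : 0 < p)
    {f : ℝ → ℝ} (hf : StrictConvexOn ℝ Set.univ f) {x : ι → ℝ} (hx : x ∈ cubeSlice ι C)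
    (hmin : IsMinOn (fun z => ∑ t, f (L t + p * z t)) (cubeSlice ι C) x)
    {i j : ι} (hi : x i < 1) (hj : 0 < x j) : L j + p * x j ≤ L i + p * x i := by
  classical
  by_contra! hlt
  have hij : i ≠ j := by
    rintro rfl
    exact lt_irrefl _ hlt
  obtain ⟨ε, hε, hεlt⟩ := exists_between (a₁ := 0)
    (a₂ := min (min (1 - x i) (x j)) ((L j + p * x j - (L i + p * x i)) / p))
    (lt_min (lt_min (by linarith) hj) (div_pos (by linarith) hp))
  simp only [lt_min_iff, lt_div_iff₀ hp] at hεlt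
  obtain ⟨⟨hεi, hεj⟩, hεgap⟩ := hεlt
  have hsum : ∀ g : ι → ℝ → ℝ,
      ∑ t, g t ((Function.update (Function.update x i (x i + ε)) j (x j - ε)) t) - ∑ t, g t (x t)
        = (g i (x i + ε) - g i (x i)) + (g j (x j - ε) - g j (x j)) := by
    intro g
    rw [← Finset.sum_sub_distrib, Finset.sum_eq_add i j hij]
    · simp [hij]
    · rintro t - ⟨hti, htj⟩
      simp [hti, htj]
    · simp
    · simp
  have hz : Function.update (Function.update x i (x i + ε)) j (x j - ε) ∈ cubeSlice ι C := by
    refine ⟨fun t => ?_, ?_⟩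
    · have := hx.1 t
      have := hx.1 i
      have := hx.1 j
      simp only [Function.update_apply]
      split_ifs <;> constructor <;> linarith
    · linarith [hsum fun _ r => r, hx.2]
  have hle : ∑ t, f (L t + p * x t) ≤ _ := hmin hz
  have htransfer := hf.add_lt_add_of_transfer (a := L i + p * x i) (b := L j + p * x j)
    (δ := ε * p) (by positivity) hεgap
  have hdiff := hsum fun t r => f (L t + p * r)
  rw [show L i + p * x i + ε * p = L i + p * (x i + ε) by ring,
    show L j + p * x j - ε * p = L j + p * (x j - ε) by ring] at htransfer
  linarith

/-- Minimizers over the cube slice agree, even for different strictly convex costs. -/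
theorem eq_of_isMinOn_cubeSlice {ι : Type*} [Fintype ι] {L : ι → ℝ} {p C : ℝ} (hp : 0 < p)
    {f g : ℝ → ℝ} (hf : StrictConvexOn ℝ Set.univ f) (hg : StrictConvexOn ℝ Set.univ g)
    {x y : ι → ℝ} (hx : x ∈ cubeSlice ι C) (hy : y ∈ cubeSlice ι C)
    (hxmin : IsMinOn (fun z => ∑ t, f (L t + p * z t)) (cubeSlice ι C) x)
    (hymin : IsMinOn (fun z => ∑ t, g (L t + p * z t)) (cubeSlice ι C) y) : x = y := by
  have hsum : ∑ t, x t = ∑ t, y t := hx.2.trans hy.2.symm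
  by_contra hne
  obtain ⟨k, hk⟩ := Function.ne_iff.1 hne
  obtain ⟨i, hi⟩ : ∃ i, x i < y i := by
    by_contra! h
    exact hk ((Finset.sum_eq_sum_iff_of_le fun t _ => h t).1 hsum.symm k (Finset.mem_univ k)).symm
  obtain ⟨j, hj⟩ : ∃ j, y j < x j := by
    by_contra! h
    exact hk ((Finset.sum_eq_sum_iff_of_le fun t _ => h t).1 hsum k (Finset.mem_univ k))
  have h1 := le_of_isMinOn_cubeSlice hp hf hx hxmin (hi.trans_le (hy.1 i).2)
    ((hy.1 j).1.trans_lt hj)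
  have h2 := le_of_isMinOn_cubeSlice hp hg hy hymin (hj.trans_le (hx.1 j).2)
    ((hx.1 i).1.trans_lt hi)
  nlinarith

/-- **Valley-filling uniqueness and cost-independence (used in the proof of Prop. IV.4).**
On `X̃ = {x ∈ ℝ^T : 0 ≤ x_t ≤ 1, Σ_t x_t = C}`, (i) for every strictly convex differentiable
`f`, the objective `x ↦ Σ_t f(L_t + p x_t)` has a unique minimizer, and (ii) this minimizer
does not depend on the strictly convex cost `f`. -/
theorem valley_filling_unique_and_cost_independent
    (T : ℕ) (hT : 1 ≤ T) (L : Fin T → ℝ) (p : ℝ) (hp : 0 < p)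
    (C : ℝ) (hC0 : 0 ≤ C) (hCT : C ≤ (T : ℝ))
    (Xt : Set (Fin T → ℝ))
    (hXt : Xt = {x | (∀ t, 0 ≤ x t ∧ x t ≤ 1) ∧ ∑ t, x t = C}) :
    -- (i) existence and uniqueness of the minimizer
    (∀ f : ℝ → ℝ, StrictConvexOn ℝ Set.univ f → Differentiable ℝ f →
      ∃! x, x ∈ Xt ∧ ∀ y ∈ Xt,
        ∑ t, f (L t + p * x t) ≤ ∑ t, f (L t + p * y t)) ∧
    -- (ii) the minimizer is independent of the strictly convex cost
    (∀ f g : ℝ → ℝ,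
      StrictConvexOn ℝ Set.univ f → Differentiable ℝ f →
      StrictConvexOn ℝ Set.univ g → Differentiable ℝ g →
      ∀ x y : Fin T → ℝ,
        (x ∈ Xt ∧ ∀ z ∈ Xt, ∑ t, f (L t + p * x t) ≤ ∑ t, f (L t + p * z t)) →
        (y ∈ Xt ∧ ∀ z ∈ Xt, ∑ t, g (L t + p * y t) ≤ ∑ t, g (L t + p * z t)) →
        x = y) := by
  replace hXt : Xt = cubeSlice (Fin T) C := hXt
  subst hXt
  have : Nonempty (Fin T) := ⟨⟨0, hT⟩⟩
  refine ⟨fun f hf hdiff => ?_, fun f g hf _ hg _ x y hx hy =>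
    eq_of_isMinOn_cubeSlice hp hf hg hx.1 hy.1 hx.2 hy.2⟩
  have hcont : Continuous f := hdiff.continuous
  obtain ⟨x, hx, hmin⟩ := (isCompact_cubeSlice (Fin T) C).exists_isMinOn
    (cubeSlice_nonempty hC0 (by simpa using hCT))
    (f := fun z => ∑ t, f (L t + p * z t)) (by fun_prop)
  exact ⟨x, ⟨hx, fun y hy => hmin hy⟩, fun y hy =>
    eq_of_isMinOn_cubeSlice hp hf hf hy.1 hx hy.2 hmin⟩
end

section
/- Let T ≥ 1, 1 ≤ C ≤ T with C ≤ T, p > 0, and let L : {1,…,T} → ℝ satisfy L_1 ≥ L_2 ≥ ⋯ ≥ L_C (L non-increasing on {1,…,C}) and L_{T−C+1} ≤ ⋯ ≤ L_T (L non-decreasing on {T−C+1,…,T}). Let f : ℝ → ℝ be strictly convex and differentiable, let X̃ = {x ∈ ℝ^T : 0 ≤ x_t ≤ 1, Σ_t x_t = C}, and let X = {x ∈ X̃ : x_1 ≤ ⋯ ≤ x_C and x_{T−C+1} ≥ ⋯ ≥ x_T}. Then the unique minimizer x̃* of x ↦ Σ_{t=1}^T f(L_t + p x_t) on X̃ satisfies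 x̃*_1 ≤ ⋯ ≤ x̃*_C and x̃*_{T−C+1} ≥ ⋯ ≥ x̃*_T; hence x̃* ∈ X and x̃* is also the unique minimizer of this objective on X. (Final step of the proof of Proposition IV.4.) -/
/-- A convex function has increasing increments. -/
theorem ConvexOn.add_le_add_of_increment {f : ℝ → ℝ} (hf : ConvexOn ℝ Set.univ f)
    {u v d : ℝ} (huv : u ≤ v) (hd : 0 ≤ d) : f (u + d) + f v ≤ f u + f (v + d) := by
  rcases huv.eq_or_lt with rfl | huv
  · linarith
  have hs : 0 < v - u + d := by linarith
  have hs' := hs.ne'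
  have h0 : 0 ≤ d / (v - u + d) := by positivity
  have h1 : 0 ≤ (v - u) / (v - u + d) := div_nonneg (by linarith) hs.le
  have h01 : (v - u) / (v - u + d) + d / (v - u + d) = 1 := by field_simp
  have e1 := hf.2 (Set.mem_univ u) (Set.mem_univ (v + d)) h1 h0 h01
  have e2 := hf.2 (Set.mem_univ u) (Set.mem_univ (v + d)) h0 h1 (by linarith)
  simp only [smul_eq_mul] at e1 e2
  rw [show (v - u) / (v - u + d) * u + d / (v - u + d) * (v + d) = u + d by
    field_simp; ring] at e1
  rw [show d / (v - u + d) * u + (v - u) / (v - u + d) * (v + d) = v by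
    field_simp; ring] at e2
  linear_combination e1 + e2 + (f u + f (v + d)) * h01

/-- A separable, strictly convex objective is strictly convex. -/
theorem StrictConvexOn.sum_affine {ι : Type*} [Fintype ι] {f : ℝ → ℝ}
    (hf : StrictConvexOn ℝ Set.univ f) (L : ι → ℝ) {p : ℝ} (hp : p ≠ 0) :
    StrictConvexOn ℝ Set.univ (fun x : ι → ℝ => ∑ t, f (L t + p * x t)) := by
  refine ⟨convex_univ, fun x _ y _ hxy a b ha hb hab => ?_⟩
  have key (t : ι) : L t + p * (a • x + b • y) t
      = a • (L t + p * x t) + b • (L t + p * y t) := by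
    simp only [Pi.add_apply, Pi.smul_apply, smul_eq_mul]
    linear_combination (-L t) * hab
  simp only [key, Finset.smul_sum, ← Finset.sum_add_distrib]
  obtain ⟨s, hs⟩ := Function.ne_iff.mp hxy
  refine Finset.sum_lt_sum
    (fun t _ => hf.convexOn.2 (Set.mem_univ _) (Set.mem_univ _) ha.le hb.le hab)
    ⟨s, Finset.mem_univ s, hf.2 (Set.mem_univ _) (Set.mem_univ _) (fun h => hs ?_) ha hb hab⟩
  exact mul_left_cancel₀ hp (add_left_cancel h)

/-- Exchanging the allocations of two slots so that the slot with the larger load receives the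
smaller allocation does not increase a convex objective. -/
theorem ConvexOn.sum_swap_le {ι : Type*} [Fintype ι] [DecidableEq ι] {f : ℝ → ℝ}
    (hf : ConvexOn ℝ Set.univ f) {L x : ι → ℝ} {p : ℝ} (hp : 0 ≤ p) {a b : ι}
    (hL : L b ≤ L a) (hx : x b ≤ x a) :
    ∑ t, f (L t + p * x (Equiv.swap a b t)) ≤ ∑ t, f (L t + p * x t) := by
  rcases eq_or_ne a b with rfl | hab
  · simp
  rw [← sub_nonpos, ← Finset.sum_sub_distrib, Fintype.sum_eq_add a b hab]
  · have h := hf.add_le_add_of_increment (u := L b + p * x b) (v := L a + p * x b)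
      (d := p * (x a - x b)) (by linarith) (mul_nonneg hp (by linarith))
    rw [show L b + p * x b + p * (x a - x b) = L b + p * x a by ring,
      show L a + p * x b + p * (x a - x b) = L a + p * x a by ring] at h
    rw [Equiv.swap_apply_left, Equiv.swap_apply_right]
    linarith
  · rintro t ⟨hta, htb⟩
    rw [Equiv.swap_apply_of_ne_of_ne hta htb, sub_self]

/-- Vectors with entries in `[0, 1]` and prescribed total form a convex set. -/
theorem convex_unitBox_sum_eq {ι : Type*} [Fintype ι] (c : ℝ) :
    Convex ℝ {x : ι → ℝ | (∀ t, 0 ≤ x t ∧ x t ≤ 1) ∧ ∑ t, x t = c} := by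
  rintro x ⟨hx, hxs⟩ y ⟨hy, hys⟩ a b ha hb hab
  refine ⟨fun t => convex_Icc (0 : ℝ) 1 (hx t) (hy t) ha hb hab, ?_⟩
  simp only [Pi.add_apply, Pi.smul_apply, smul_eq_mul, Finset.sum_add_distrib,
    ← Finset.mul_sum, hxs, hys]
  rw [← add_mul, hab, one_mul]

/-- **Final step of the proof of Proposition IV.4.** If the exogenous load `L` is
non-increasing on the first `C` slots and non-decreasing on the last `C` slots (indices of
`Fin T` representing times `1,…,T`), then the unique minimizer `x̃*` of
`x ↦ Σ_t f(L_t + p x_t)` on `X̃ = {0 ≤ x_t ≤ 1, Σ_t x_t = C}` satisfies the boundary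
monotonicity constraints, i.e. `x̃* ∈ X`, and `x̃*` is also the unique minimizer of the
objective on `X`. -/
theorem valley_filling_minimizer_in_constrained_set
    (T C : ℕ) (hC1 : 1 ≤ C) (hCT : C ≤ T)
    (L : Fin T → ℝ) (p : ℝ) (hp : 0 < p)
    -- L non-increasing on the first C slots
    (hLdec : ∀ a b : Fin T, a ≤ b → (b : ℕ) + 1 ≤ C → L b ≤ L a)
    -- L non-decreasing on the last C slots
    (hLinc : ∀ a b : Fin T, a ≤ b → T - C ≤ (a : ℕ) → L a ≤ L b)
    (f : ℝ → ℝ) (hfc : StrictConvexOn ℝ Set.univ f) (hfd : Differentiable ℝ f)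
    (Xt : Set (Fin T → ℝ))
    (hXt : Xt = {x | (∀ t, 0 ≤ x t ∧ x t ≤ 1) ∧ ∑ t, x t = (C : ℝ)})
    (X : Set (Fin T → ℝ))
    (hX : X = {x ∈ Xt |
      (∀ a b : Fin T, a ≤ b → (b : ℕ) + 1 ≤ C → x a ≤ x b) ∧
      (∀ a b : Fin T, a ≤ b → T - C ≤ (a : ℕ) → x b ≤ x a)})
    (xstar : Fin T → ℝ) (hmem : xstar ∈ Xt)
    (hmin : ∀ y ∈ Xt, ∑ t, f (L t + p * xstar t) ≤ ∑ t, f (L t + p * y t)) :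
    xstar ∈ X ∧
    (∀ y ∈ X, ∑ t, f (L t + p * xstar t) ≤ ∑ t, f (L t + p * y t)) ∧
    (∀ y, y ∈ X → (∀ z ∈ X, ∑ t, f (L t + p * y t) ≤ ∑ t, f (L t + p * z t)) →
      y = xstar) := by
  subst hXt
  have huniq : ∀ y ∈ {x : Fin T → ℝ | (∀ t, 0 ≤ x t ∧ x t ≤ 1) ∧ ∑ t, x t = (C : ℝ)},
      ∑ t, f (L t + p * y t) ≤ ∑ t, f (L t + p * xstar t) → y = xstar := by
    intro y hy hle
    have hconv := (hfc.sum_affine L hp.ne').subset (Set.subset_univ _)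
      (convex_unitBox_sum_eq (C : ℝ))
    exact hconv.eq_of_isMinOn (fun z hz => hle.trans (hmin z hz)) (fun z hz => hmin z hz)
      hy hmem
  have hmono : ∀ a b : Fin T, L b ≤ L a → xstar a ≤ xstar b := by
    intro a b hL
    by_contra! hx
    have h := huniq (fun t => xstar (Equiv.swap a b t))
      ⟨fun t => hmem.1 _, (Equiv.sum_comp (Equiv.swap a b) xstar).trans hmem.2⟩
      (hfc.convexOn.sum_swap_le hp.le hL hx.le)
    have h' := congrFun h a
    simp only [Equiv.swap_apply_left] at h'
    exact hx.ne h'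
  have hmemX : xstar ∈ X := by
    rw [hX]
    exact ⟨hmem, fun a b hab hb => hmono a b (hLdec a b hab hb),
      fun a b hab ha => hmono b a (hLinc a b hab ha)⟩
  have hsub : ∀ y ∈ X, y ∈ {x : Fin T → ℝ | (∀ t, 0 ≤ x t ∧ x t ≤ 1) ∧
      ∑ t, x t = (C : ℝ)} := by
    intro y hy
    rw [hX] at hy
    exact hy.1
  exact ⟨hmemX, fun y hy => hmin y (hsub y hy),
    fun y hy hymin => huniq y (hsub y hy) (hymin xstar hmemX)⟩
end

section
/- Price of decentralization zero in the non-atomic charging game (Proposition IV.4): let T ≥ 1, 1 ≤ C ≤ T, p > 0, and let L : {1,…,T} → ℝ satisfy L_1 ≥ ⋯ ≥ L_C and L_{T−C+1} ≤ ⋯ ≤ L_T. Let g : ℝ → ℝ be continuous, strictly increasing, strictly convex and differentiable (the per-slot distribution-network cost, e.g. α·aging + (1−α)·energy losses with no thermal inertia). Define on X = {x ∈ ℝ^T : 0 ≤ x_t ≤ 1, Σ_t x_t = C, x_1 ≤ ⋯ ≤ x_C, x_{T−C+1} ≥ ⋯ ≥ x_T} the potential objective Φ(x) = Σ_{t=1}^T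 ∫_0^{x_t} g(L_t + p v) dv and the social cost W(x) = Σ_{t=1}^T g(L_t + p x_t). Then Φ and W each attain their minimum on X at a unique point, and these two minimizers coincide. Consequently the unique Nash equilibrium profile of the non-atomic charging game (the minimizer of the potential Φ) also minimizes the total cost W, i.e., PoD = 0. -/
/-- A function on `ℝ` with strictly increasing derivative lies strictly above its tangents. -/
lemma tangent_lt_of_hasDerivAt_of_strictMono {f f' : ℝ → ℝ} (hf : ∀ u, HasDerivAt f (f' u) u)
    (hf' : StrictMono f') {x y : ℝ} (hxy : y ≠ x) : f x + f' x * (y - x) < f y := by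
  have hcont : Continuous f := continuous_iff_continuousAt.2 fun u => (hf u).continuousAt
  have hconv : StrictConvexOn ℝ Set.univ f := by
    refine StrictMono.strictConvexOn_univ_of_deriv hcont ?_
    rwa [show deriv f = f' from funext fun u => (hf u).deriv]
  rcases hxy.lt_or_gt with h | h
  · have := hconv.slope_lt_of_hasDerivAt (Set.mem_univ y) (Set.mem_univ x) h (hf x)
    rw [slope_def_field, div_lt_iff₀ (sub_pos.2 h)] at this
    linarith
  · have := hconv.lt_slope_of_hasDerivAt (Set.mem_univ x) (Set.mem_univ y) h (hf x)
    rw [slope_def_field, lt_div_iff₀ (sub_pos.2 h)] at this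
    linarith

/-- The profile that fills every slot up to the common load level `μ`, as far as the bounds
`0 ≤ x ≤ 1` allow. -/
noncomputable def waterFilling {ι : Type*} (L : ι → ℝ) (p μ : ℝ) (t : ι) : ℝ :=
  max 0 (min 1 ((μ - L t) / p))

section waterFilling

variable {ι : Type*} (L : ι → ℝ) {p : ℝ} (μ : ℝ)

lemma waterFilling_nonneg (t : ι) : 0 ≤ waterFilling L p μ t := le_max_left _ _

lemma waterFilling_le_one (t : ι) : waterFilling L p μ t ≤ 1 :=
  max_le zero_le_one (min_le_left _ _)

lemma waterFilling_le_of_le (hp : 0 < p) {a b : ι} (h : L b ≤ L a) :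
    waterFilling L p μ a ≤ waterFilling L p μ b := by
  unfold waterFilling
  gcongr

lemma exists_sum_waterFilling_eq [Fintype ι] (hp : 0 < p) {c : ℝ} (hc0 : 0 ≤ c)
    (hc : c ≤ Fintype.card ι) : ∃ μ, ∑ t, waterFilling L p μ t = c := by
  have hcont : Continuous fun μ => ∑ t, waterFilling L p μ t := by
    unfold waterFilling
    fun_prop
  have hL (t : ι) : |L t| ≤ ∑ s, |L s| :=
    Finset.single_le_sum (f := fun s => |L s|) (fun s _ => abs_nonneg _) (Finset.mem_univ t)
  have hlow : ∑ t, waterFilling L p (-∑ s, |L s|) t = 0 := by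
    refine Finset.sum_eq_zero fun t _ => max_eq_left ((min_le_right _ _).trans ?_)
    exact div_nonpos_of_nonpos_of_nonneg (by linarith [hL t, neg_abs_le (L t)]) hp.le
  have hhigh : ∑ t, waterFilling L p (∑ s, |L s| + p) t = Fintype.card ι := by
    have h (t : ι) : waterFilling L p (∑ s, |L s| + p) t = 1 := by
      have : 1 ≤ (∑ s, |L s| + p - L t) / p := by
        rw [le_div_iff₀ hp]
        linarith [hL t, le_abs_self (L t)]
      simp [waterFilling, min_eq_left this]
    simp [h]
  exact intermediate_value_univ (-∑ s, |L s|) (∑ s, |L s| + p) hcont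
    ⟨hlow.trans_le hc0, hc.trans_eq hhigh.symm⟩

/-- The variational inequality satisfied by the water-filling profile in each slot. -/
lemma waterFilling_variational (hp : 0 < p) {h : ℝ → ℝ} (hh : Monotone h) (t : ι) {y : ℝ}
    (hy0 : 0 ≤ y) (hy1 : y ≤ 1) :
    h μ * (y - waterFilling L p μ t) ≤
      h (L t + p * waterFilling L p μ t) * (y - waterFilling L p μ t) := by
  have hmul : p * ((μ - L t) / p) = μ - L t := mul_div_cancel₀ _ hp.ne'
  rcases le_total ((μ - L t) / p) 0 with h0 | h0
  · have hx : waterFilling L p μ t = 0 := max_eq_left ((min_le_right _ _).trans h0)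
    rw [hx]
    refine mul_le_mul_of_nonneg_right (hh ?_) (by linarith)
    nlinarith
  rcases le_total 1 ((μ - L t) / p) with h1 | h1
  · have hx : waterFilling L p μ t = 1 := by simp [waterFilling, min_eq_left h1]
    rw [hx]
    refine mul_le_mul_of_nonpos_right (hh ?_) (by linarith)
    nlinarith
  · have hx : waterFilling L p μ t = (μ - L t) / p := by
      simp [waterFilling, min_eq_right h1, max_eq_right h0]
    rw [hx, hmul, add_sub_cancel]

/-- The water-filling profile is the strict minimizer, among profiles with values in `[0, 1]` and
the same total, of every separable cost whose marginal costs are a strictly increasing function of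
the load. -/
theorem sum_waterFilling_lt [Fintype ι] (hp : 0 < p) {h : ℝ → ℝ} (hh : StrictMono h)
    {f : ι → ℝ → ℝ} (hf : ∀ t u, HasDerivAt (f t) (h (L t + p * u)) u) {y : ι → ℝ}
    (hy : ∀ t, 0 ≤ y t ∧ y t ≤ 1) (hsum : ∑ t, y t = ∑ t, waterFilling L p μ t)
    (hne : y ≠ waterFilling L p μ) :
    ∑ t, f t (waterFilling L p μ t) < ∑ t, f t (y t) := by
  set x := waterFilling L p μ
  have hmono (t : ι) : StrictMono fun u => h (L t + p * u) := fun u v huv =>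
    hh (by gcongr)
  have hlt (t : ι) (ht : y t ≠ x t) : f t (x t) + h μ * (y t - x t) < f t (y t) :=
    (add_le_add_right (waterFilling_variational L μ hp hh.monotone t (hy t).1 (hy t).2) _).trans_lt
      (tangent_lt_of_hasDerivAt_of_strictMono (hf t) (hmono t) ht)
  have hle (t : ι) : f t (x t) + h μ * (y t - x t) ≤ f t (y t) := by
    by_cases ht : y t = x t
    · simp [ht]
    · exact (hlt t ht).le
  obtain ⟨s, hs⟩ := Function.ne_iff.1 hne
  have key := Finset.sum_lt_sum (fun t _ => hle t) ⟨s, Finset.mem_univ s, hlt s hs⟩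
  rwa [Finset.sum_add_distrib, ← Finset.mul_sum, Finset.sum_sub_distrib, hsum, sub_self, mul_zero,
    add_zero] at key

end waterFilling


/-- **Proposition IV.4 (PoD = 0 in the non-atomic charging game).** Under the monotonicity
assumptions on the exogenous load, the potential `Φ(x) = Σ_t ∫_0^{x_t} g(L_t + p v) dv` and
the social cost `W(x) = Σ_t g(L_t + p x_t)` each have a unique minimizer on the feasible set
`X`, and these minimizers coincide: the unique Nash equilibrium of the non-atomic charging
game is socially optimal, i.e. the price of decentralization is zero. -/
theorem nonatomic_charging_game_PoD_zero
    (T C : ℕ) (hT : 1 ≤ T) (hC1 : 1 ≤ C) (hCT : C ≤ T)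
    (L : Fin T → ℝ) (p : ℝ) (hp : 0 < p)
    -- L non-increasing on the first C slots
    (hLdec : ∀ a b : Fin T, a ≤ b → (b : ℕ) + 1 ≤ C → L b ≤ L a)
    -- L non-decreasing on the last C slots
    (hLinc : ∀ a b : Fin T, a ≤ b → T - C ≤ (a : ℕ) → L a ≤ L b)
    -- per-slot distribution-network cost
    (g : ℝ → ℝ) (hgc : Continuous g) (hgm : StrictMono g)
    (hgconv : StrictConvexOn ℝ Set.univ g) (hgd : Differentiable ℝ g)
    -- feasible set
    (X : Set (Fin T → ℝ))
    (hX : X = {x | (∀ t, 0 ≤ x t ∧ x t ≤ 1) ∧ ∑ t, x t = (C : ℝ) ∧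
      (∀ a b : Fin T, a ≤ b → (b : ℕ) + 1 ≤ C → x a ≤ x b) ∧
      (∀ a b : Fin T, a ≤ b → T - C ≤ (a : ℕ) → x b ≤ x a)})
    -- potential objective and social cost
    (Φ W : (Fin T → ℝ) → ℝ)
    (hΦ : ∀ x, Φ x = ∑ t, ∫ v in (0 : ℝ)..(x t), g (L t + p * v))
    (hW : ∀ x, W x = ∑ t, g (L t + p * x t)) :
    ∃ xstar, xstar ∈ X ∧
      (∀ y ∈ X, Φ xstar ≤ Φ y) ∧
      (∀ y ∈ X, W xstar ≤ W y) ∧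
      (∀ y, y ∈ X → (∀ z ∈ X, Φ y ≤ Φ z) → y = xstar) ∧
      (∀ y, y ∈ X → (∀ z ∈ X, W y ≤ W z) → y = xstar) := by
  obtain ⟨μ, hμ⟩ := exists_sum_waterFilling_eq L hp (c := (C : ℝ)) (Nat.cast_nonneg C)
    (by simpa using hCT)
  have hmem : waterFilling L p μ ∈ X := by
    rw [hX]
    exact ⟨fun t => ⟨waterFilling_nonneg L μ t, waterFilling_le_one L μ t⟩, hμ,
      fun a b hab hb => waterFilling_le_of_le L μ hp (hLdec a b hab hb),
      fun a b hab ha => waterFilling_le_of_le L μ hp (hLinc a b hab ha)⟩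
  have hΦlt (y) (hy : y ∈ X) (hne : y ≠ waterFilling L p μ) : Φ (waterFilling L p μ) < Φ y := by
    rw [hX] at hy
    rw [hΦ, hΦ]
    refine sum_waterFilling_lt L μ hp hgm
      (f := fun t u => ∫ v in (0 : ℝ)..u, g (L t + p * v)) (fun t u => ?_) hy.1
      (hy.2.1.trans hμ.symm) hne
    have hc : Continuous fun v => g (L t + p * v) := by fun_prop
    exact (hc.integral_hasStrictDerivAt 0 u).hasDerivAt
  have hWlt (y) (hy : y ∈ X) (hne : y ≠ waterFilling L p μ) : W (waterFilling L p μ) < W y := by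
    rw [hX] at hy
    rw [hW, hW]
    have hg' : StrictMono (deriv g) := strictMonoOn_univ.1
      (hgconv.strictMonoOn_deriv fun x _ => hgd x)
    refine sum_waterFilling_lt L μ hp (h := fun z => deriv g z * p) (hg'.mul_const hp)
      (f := fun t u => g (L t + p * u)) (fun t u => ?_) hy.1 (hy.2.1.trans hμ.symm) hne
    have haff : HasDerivAt (fun u => L t + p * u) p u := by
      simpa using ((hasDerivAt_id u).const_mul p).const_add (L t)
    exact (hgd _).hasDerivAt.comp u haff
  refine ⟨waterFilling L p μ, hmem, fun y hy => ?_, fun y hy => ?_, fun y hy hmin => ?_,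
    fun y hy hmin => ?_⟩
  · rcases eq_or_ne y (waterFilling L p μ) with rfl | hne
    exacts [le_rfl, (hΦlt y hy hne).le]
  · rcases eq_or_ne y (waterFilling L p μ) with rfl | hne
    exacts [le_rfl, (hWlt y hy hne).le]
  · by_contra hne
    exact (hΦlt y hy hne).not_ge (hmin _ hmem)
  · by_contra hne
    exact (hWlt y hy hne).not_ge (hmin _ hmem)
end
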